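/- Let P be a poset containing an element c such that either (a) for every x ∈ P the greatest lower bound of {c, x} exists in P, or (b) for every x ∈ P the least upper bound of {c, x} exists in P. Then the geometric realization of the nerve of P (P regarded as a category) is a contractible topological space. -/

import Mathlib

open CategoryTheory

universe u

section helpers
open Simplicial Opposite

variable {P : Type} [PartialOrder P]

/-- The simplex of the nerve attached to a chain. -/
def chainSimplex {n : ℕ} (q : Fin (n + 1) →o P) : (nerve P).obj (op ⦋n⦌) := q.monotone.functor

/-- The characteristic map of a chain. -/
noncomputable def pt {n : ℕ} (q : Fin (n + 1) →o P) :
    C(stdSimplex ℝ (Fin (n + 1)), SSet.toTop.obj (nerve P)) :=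
  TopCat.toSSetObjEquiv _ (op ⦋n⦌) ((sSetTopAdj.unit.app (nerve P)).app _ (chainSimplex q))

lemma pt_map {n m : ℕ} (q : Fin (m + 1) →o P) (α : Fin (n + 1) →o Fin (m + 1))
    (w : stdSimplex ℝ (Fin (n + 1))) :
    pt (q.comp α) w = pt q (stdSimplex.map α w) := by
  have h1 : chainSimplex (q.comp α) =
      (nerve P).map (SimplexCategory.mkHom α).op (chainSimplex q) := rfl
  have h2 := ConcreteCategory.congr_hom
    ((sSetTopAdj.unit.app (nerve P)).naturality (SimplexCategory.mkHom α).op) (chainSimplex q)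
  unfold pt
  rw [h1]
  refine (congrArg (fun z => TopCat.toSSetObjEquiv _ (op ⦋n⦌) z w) h2).trans ?_
  rfl

lemma exists_lift {Z : Type} [TopologicalSpace Z]
    (φ : ∀ n : ℕ, (Fin (n + 1) →o P) → C(stdSimplex ℝ (Fin (n + 1)), Z))
    (hφ : ∀ (n m : ℕ) (q : Fin (m + 1) →o P) (α : Fin (n + 1) →o Fin (m + 1))
      (w : stdSimplex ℝ (Fin (n + 1))), φ n (q.comp α) w = φ m q (stdSimplex.map α w)) :
    ∃ Φ : C(SSet.toTop.obj (nerve P), Z),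
      ∀ (n : ℕ) (q : Fin (n + 1) →o P) (w : stdSimplex ℝ (Fin (n + 1))),
        Φ (pt q w) = φ n q w := by
  let G : nerve P ⟶ TopCat.toSSet.obj (TopCat.of Z) :=
    { app := fun n => TypeCat.ofHom fun x => (TopCat.toSSetObjEquiv (TopCat.of Z) n).symm
        (φ n.unop.len ⟨x.obj, x.monotone⟩)
      naturality := by
        intro n m f
        ext x
        apply (TopCat.toSSetObjEquiv (TopCat.of Z) m).injective
        ext w
        exact hφ _ _ ⟨x.obj, x.monotone⟩ f.unop.toOrderHom w }
  refine ⟨((sSetTopAdj.homEquiv _ _).symm G).hom, fun n q w => ?_⟩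
  have h : sSetTopAdj.unit.app (nerve P) ≫ TopCat.toSSet.map ((sSetTopAdj.homEquiv _ _).symm G)
      = G :=
    (Adjunction.homEquiv_unit ..).symm.trans (Equiv.apply_symm_apply _ _)
  have h2 := congrArg (fun k => TopCat.toSSetObjEquiv (TopCat.of Z) (op ⦋n⦌)
    (k.app (op ⦋n⦌) (chainSimplex q)) w) h
  exact h2

lemma hom_ext_pt {Z : Type} [TopologicalSpace Z] {Φ Ψ : C(SSet.toTop.obj (nerve P), Z)}
    (h : ∀ (n : ℕ) (q : Fin (n + 1) →o P) (w : stdSimplex ℝ (Fin (n + 1))),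
        Φ (pt q w) = Ψ (pt q w)) : Φ = Ψ := by
  have : (TopCat.ofHom Φ : SSet.toTop.obj (nerve P) ⟶ TopCat.of Z) = TopCat.ofHom Ψ := by
    apply (sSetTopAdj.homEquiv _ _).injective
    rw [Adjunction.homEquiv_unit, Adjunction.homEquiv_unit]
    ext n x
    apply (TopCat.toSSetObjEquiv (TopCat.of Z) n).injective
    ext w
    exact h n.unop.len ⟨x.obj, x.monotone⟩ w
  exact congrArg TopCat.Hom.hom this

lemma exists_pt (y : SSet.toTop.obj (nerve P)) :
    ∃ (n : ℕ) (q : Fin (n + 1) →o P) (w : stdSimplex ℝ (Fin (n + 1))), pt q w = y := by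
  let _ : TopologicalSpace Prop := ⊤
  let Φ : C(SSet.toTop.obj (nerve P), Prop) := ⟨fun y => ∃ (n : ℕ) (q : Fin (n + 1) →o P)
    (w : stdSimplex ℝ (Fin (n + 1))), pt q w = y, continuous_top⟩
  let Ψ : C(SSet.toTop.obj (nerve P), Prop) := ⟨fun y => True, continuous_top⟩
  have : Φ = Ψ := hom_ext_pt fun n q w => eq_true ⟨n, q, w, rfl⟩
  exact of_eq_true (congrArg (fun k => k y) this)


lemma sum_map_mul {n m : ℕ} (α : Fin n → Fin m) (w : stdSimplex ℝ (Fin n)) (G : Fin m → ℝ) :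
    ∑ j, stdSimplex.map α w j * G j = ∑ i, w i * G (α i) := by
  classical
  simp only [stdSimplex.map_coe, FunOnFinite.linearMap_apply_apply, Finset.sum_mul]
  rw [← Finset.sum_fiberwise Finset.univ α]
  refine Finset.sum_congr rfl fun j _ => Finset.sum_congr rfl fun i hi => ?_
  rw [(Finset.mem_filter.1 hi).2]

open Classical in
/-- The weight at `p` of the point with coordinates `w` in the simplex of the chain `q`. -/
noncomputable def wtf {n : ℕ} (q : Fin (n + 1) →o P) (w : stdSimplex ℝ (Fin (n + 1))) (p : P) : ℝ :=
  ∑ i, w i * (if q i = p then 1 else 0)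

lemma exists_wt (P : Type) [PartialOrder P] : ∃ Φ : C(SSet.toTop.obj (nerve P), P → ℝ),
      ∀ (n : ℕ) (q : Fin (n + 1) →o P) (w : stdSimplex ℝ (Fin (n + 1))),
        Φ (pt q w) = wtf q w := by
  classical
  refine exists_lift (fun n q => ⟨fun w => wtf q w, ?_⟩) ?_
  · unfold wtf
    refine continuous_pi fun p => continuous_finsetSum _ fun i _ => ?_
    exact ((continuous_apply i).comp continuous_subtype_val).mul continuous_const
  · intro n m q α w
    ext p
    exact (sum_map_mul α w (fun j => if q j = p then 1 else 0)).symm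

/-- The weight function. -/
noncomputable def wt (y : SSet.toTop.obj (nerve P)) : P → ℝ := (exists_wt P).choose y

lemma wt_pt {n : ℕ} (q : Fin (n + 1) →o P) (w : stdSimplex ℝ (Fin (n + 1))) :
    wt (pt q w) = wtf q w := (exists_wt P).choose_spec n q w

lemma map_pos {n m : ℕ} (α : Fin n → Fin m) (hα : Function.Surjective α)
    (w : stdSimplex ℝ (Fin n)) (hw : ∀ i, 0 < w i) (j : Fin m) : 0 < stdSimplex.map α w j := by
  classical
  obtain ⟨i, hi⟩ := hα j
  simp only [stdSimplex.map_coe, FunOnFinite.linearMap_apply_apply]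
  exact Finset.sum_pos (fun i _ => hw i) ⟨i, by simpa using hi⟩

lemma exists_pt_pos (y : SSet.toTop.obj (nerve P)) :
    ∃ (n : ℕ) (q : Fin (n + 1) →o P) (w : stdSimplex ℝ (Fin (n + 1))),
      pt q w = y ∧ ∀ i, 0 < w i := by
  classical
  have hex : ∃ n : ℕ, ∃ (q : Fin (n + 1) →o P) (w : stdSimplex ℝ (Fin (n + 1))), pt q w = y :=
    exists_pt y
  obtain ⟨q, w, h⟩ := Nat.find_spec hex
  refine ⟨_, q, w, h, ?_⟩
  by_contra! hw
  obtain ⟨i, hi⟩ := hw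
  have hi0 : w i = 0 := le_antisymm hi (stdSimplex.zero_le w i)
  have hmin := fun m => Nat.find_min hex (m := m)
  generalize Nat.find hex = N at q w h i hi hi0 hmin
  cases N with
  | zero =>
    have := stdSimplex.sum_eq_one w
    obtain rfl : i = 0 := Fin.fin_one_eq_zero i
    rw [Fin.sum_univ_one] at this
    exact zero_ne_one (hi0.symm.trans this)
  | succ n =>
    apply hmin n (Nat.lt_succ_self n)
    have h1 : ∑ j, w (i.succAbove j) = 1 := by
      have := stdSimplex.sum_eq_one w
      rw [Fin.sum_univ_succAbove _ i, hi0, zero_add] at this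
      exact this
    let w' : stdSimplex ℝ (Fin (n + 1)) :=
      ⟨fun j => w (i.succAbove j), fun j => stdSimplex.zero_le w _, h1⟩
    refine ⟨q.comp (Fin.succAboveOrderEmb i).toOrderHom, w', ?_⟩
    rw [pt_map, ← h]
    congr 1
    apply stdSimplex.ext
    funext j
    have hs := fun j => sum_map_mul i.succAbove w' (fun k => if k = j then 1 else 0)
    have hs := hs j
    simp only [mul_ite, mul_one, mul_zero, Finset.sum_ite_eq', Finset.mem_univ, if_true] at hs
    refine hs.trans ?_
    by_cases hj : j = i
    · subst hj
      rw [hi0]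
      exact Finset.sum_eq_zero fun k _ => if_neg (Fin.succAbove_ne _ _)
    · obtain ⟨k, rfl⟩ := Fin.exists_succAbove_eq hj
      simp [w']
      rfl

lemma exists_pt_strict (y : SSet.toTop.obj (nerve P)) :
    ∃ (n : ℕ) (q : Fin (n + 1) →o P) (w : stdSimplex ℝ (Fin (n + 1))),
      pt q w = y ∧ (∀ i, 0 < w i) ∧ StrictMono q := by
  obtain ⟨n, q, w, h, hw⟩ := exists_pt_pos y
  obtain ⟨m, f, hf, x, hx⟩ := (nerve P).exists_nonDegenerate (chainSimplex q)
  refine ⟨m, ⟨x.1.obj, x.1.monotone⟩, stdSimplex.map f w, ?_, ?_, ?_⟩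
  · rw [← h]
    refine (pt_map _ f.toOrderHom w).symm.trans ?_
    have hq : (OrderHom.comp ⟨x.1.obj, x.1.monotone⟩ f.toOrderHom : Fin (n + 1) →o P) = q := by
      ext i
      exact (congrArg (fun k => k.obj i) hx).symm
    exact congrArg (fun k => pt k w) hq
  · intro i
    exact map_pos _ (SimplexCategory.epi_iff_surjective.1 hf) w hw i
  · exact (PartialOrder.mem_nerve_nonDegenerate_iff_strictMono x.1).1 x.2

lemma wtf_pos_iff {n : ℕ} (q : Fin (n + 1) →o P) (w : stdSimplex ℝ (Fin (n + 1)))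
    (hw : ∀ i, 0 < w i) (p : P) : 0 < wtf q w p ↔ p ∈ Set.range q := by
  classical
  unfold wtf
  constructor
  · intro h
    by_contra hp
    refine h.ne' (Finset.sum_eq_zero fun i _ => ?_)
    rw [if_neg (fun h => hp ⟨i, h⟩), mul_zero]
  · rintro ⟨i, rfl⟩
    refine Finset.sum_pos' (fun j _ => ?_) ⟨i, Finset.mem_univ _, by simpa using hw i⟩
    exact mul_nonneg (hw j).le (by split_ifs <;> norm_num)

lemma wtf_apply {n : ℕ} (q : Fin (n + 1) →o P) (w : stdSimplex ℝ (Fin (n + 1)))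
    (hq : StrictMono q) (i : Fin (n + 1)) : wtf q w (q i) = w i := by
  classical
  unfold wtf
  simp [hq.injective.eq_iff]

lemma wt_injective : Function.Injective (wt (P := P)) := by
  intro y z h
  obtain ⟨n, q, w, rfl, hw, hq⟩ := exists_pt_strict y
  obtain ⟨m, r, v, rfl, hv, hr⟩ := exists_pt_strict z
  rw [wt_pt, wt_pt] at h
  have hrange : Set.range q = Set.range r := by
    ext p
    rw [← wtf_pos_iff q w hw, ← wtf_pos_iff r v hv, h]
  have hnm : n = m := by
    have := congrArg Set.ncard hrange
    rw [← Set.image_univ, ← Set.image_univ, Set.ncard_image_of_injective _ hq.injective,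
      Set.ncard_image_of_injective _ hr.injective] at this
    simpa using this
  subst hnm
  have hqr : q = r := by
    ext1
    exact (hq.range_inj hr).1 hrange
  subst hqr
  congr 1
  apply stdSimplex.ext
  funext i
  rw [← wtf_apply q w hq, ← wtf_apply q v hq, h]


/-- The part of the mass at `i` lying in the initial segment of total mass `r`. -/
noncomputable def cut {n : ℕ} (r : ℝ) (w : Fin n → ℝ) (i : Fin n) : ℝ :=
  min (∑ j ∈ Finset.Iic i, w j) r - min (∑ j ∈ Finset.Iio i, w j) r

lemma sum_Iic_fin {n : ℕ} (w : Fin n → ℝ) (i : Fin n) :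
    ∑ j ∈ Finset.Iic i, w j = w i + ∑ j ∈ Finset.Iio i, w j := by
  rw [← Finset.Iio_insert, Finset.sum_insert (by simp)]

lemma cut_nonneg {n : ℕ} (r : ℝ) (w : Fin n → ℝ) (hw : ∀ i, 0 ≤ w i) (i : Fin n) :
    0 ≤ cut r w i := by
  have := hw i
  rw [cut, sum_Iic_fin, sub_nonneg]
  exact min_le_min_right _ (by linarith)

lemma cut_le {n : ℕ} (r : ℝ) (w : Fin n → ℝ) (hw : ∀ i, 0 ≤ w i) (i : Fin n) :
    cut r w i ≤ w i := by
  have := hw i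
  rw [cut, sum_Iic_fin]
  rcases min_cases (w i + ∑ j ∈ Finset.Iio i, w j) r with h | h <;>
  rcases min_cases (∑ j ∈ Finset.Iio i, w j) r with h' | h' <;> linarith

lemma sum_cut {n : ℕ} (r : ℝ) (hr : 0 ≤ r) (w : Fin n → ℝ) (D : Finset (Fin n))
    (hD : IsLowerSet (D : Set (Fin n))) : ∑ i ∈ D, cut r w i = min (∑ i ∈ D, w i) r := by
  induction D using Finset.induction_on_max with
  | empty => simp [hr]
  | insert m D hm ih =>
    have hDm : D = Finset.Iio m := by
      ext i
      rw [Finset.mem_Iio]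
      refine ⟨hm i, fun hi => ?_⟩
      have : i ∈ ((insert m D : Finset (Fin n)) : Set (Fin n)) := hD hi.le (by simp)
      simp only [Finset.coe_insert, Set.mem_insert_iff, Finset.mem_coe] at this
      exact this.resolve_left hi.ne
    subst hDm
    rw [Finset.sum_insert (by simp), ih (by simpa using isLowerSet_Iio m), Finset.Iio_insert, cut]
    ring

lemma sum_cut_map {n m : ℕ} (r : ℝ) (hr : 0 ≤ r) (α : Fin n →o Fin m) (w : Fin n → ℝ)
    (v : Fin m → ℝ) (hv : ∀ j, v j = ∑ i with α i = j, w i) (j : Fin m) :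
    cut r v j = ∑ i with α i = j, cut r w i := by
  have h1 : ∑ i with α i ≤ j, cut r w i = min (∑ i with α i ≤ j, w i) r :=
    sum_cut r hr w _ (by
      intro a b hab ha
      simp only [Finset.coe_filter, Finset.mem_univ, true_and, Set.mem_ofPred_eq] at ha ⊢
      exact (α.monotone hab).trans ha)
  have h2 : ∑ i with α i < j, cut r w i = min (∑ i with α i < j, w i) r :=
    sum_cut r hr w _ (by
      intro a b hab ha
      simp only [Finset.coe_filter, Finset.mem_univ, true_and, Set.mem_ofPred_eq] at ha ⊢
      exact (α.monotone hab).trans_lt ha)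
  have h3 : ∑ k ∈ Finset.Iic j, v k = ∑ i with α i ≤ j, w i := by
    simp only [hv]
    rw [Finset.sum_fiberwise_eq_sum_filter]
    simp
  have h4 : ∑ k ∈ Finset.Iio j, v k = ∑ i with α i < j, w i := by
    simp only [hv]
    rw [Finset.sum_fiberwise_eq_sum_filter]
    simp
  have h5 : ∑ i with α i ≤ j, cut r w i
      = ∑ i with α i = j, cut r w i + ∑ i with α i < j, cut r w i := by
    rw [← Finset.sum_union]
    · congr 1
      ext i
      simp [le_iff_eq_or_lt]
    · rw [Finset.disjoint_left]
      intro i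
      simp only [Finset.mem_filter, Finset.mem_univ, true_and]
      intro h h'
      exact h'.ne h
  rw [cut, h3, h4, ← h1, ← h2, h5]
  ring

lemma cut_zero {n : ℕ} (w : Fin n → ℝ) (hw : ∀ i, 0 ≤ w i) (i : Fin n) : cut 0 w i = 0 := by
  rw [cut, min_eq_right (Finset.sum_nonneg fun i _ => hw i),
    min_eq_right (Finset.sum_nonneg fun i _ => hw i), sub_zero]

lemma cut_one {n : ℕ} (w : stdSimplex ℝ (Fin n)) (i : Fin n) : cut 1 w i = w i := by
  have h (D : Finset (Fin n)) : ∑ i ∈ D, w i ≤ 1 := by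
    rw [← stdSimplex.sum_eq_one w]
    exact Finset.sum_le_sum_of_subset_of_nonneg (Finset.subset_univ _)
      fun i _ _ => stdSimplex.zero_le w i
  rw [cut, min_eq_left (h _), min_eq_left (h _), sum_Iic_fin]
  ring

lemma exists_cut {n : ℕ} (w : stdSimplex ℝ (Fin (n + 1))) (r : ℝ) (h0 : 0 ≤ r) (h1 : r ≤ 1) :
    ∃ k, ∑ j ∈ Finset.Iio k, w j ≤ r ∧ r ≤ ∑ j ∈ Finset.Iic k, w j := by
  obtain ⟨k, hk, hmin⟩ := WellFounded.has_min (wellFounded_lt (α := Fin (n + 1)))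
    {k | r ≤ ∑ j ∈ Finset.Iic k, w j} ⟨Fin.last n, by
      have : Finset.Iic (Fin.last n) = Finset.univ := by ext; simp [Fin.le_last]
      rw [Set.mem_ofPred_eq, this, stdSimplex.sum_eq_one w]
      exact h1⟩
  refine ⟨k, ?_, hk⟩
  rcases Fin.eq_zero_or_eq_succ k with rfl | ⟨i, rfl⟩
  · have : Finset.Iio (0 : Fin (n + 1)) = ∅ := by ext; simp
    rw [this, Finset.sum_empty]
    exact h0
  · have h := hmin i.castSucc
    have : Finset.Iio i.succ = Finset.Iic i.castSucc := by
      ext j; simp [Fin.lt_def, Fin.le_def]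
    rw [this]
    by_contra! hlt
    exact h hlt.le (Fin.castSucc_lt_succ)

lemma cut_of_gt {n : ℕ} {w : Fin n → ℝ} (hw : ∀ i, 0 ≤ w i) {r : ℝ} {k i : Fin n}
    (hk : r ≤ ∑ j ∈ Finset.Iic k, w j) (hi : k < i) : cut r w i = 0 := by
  have h1 : ∑ j ∈ Finset.Iic k, w j ≤ ∑ j ∈ Finset.Iio i, w j :=
    Finset.sum_le_sum_of_subset_of_nonneg (fun j hj => by
      rw [Finset.mem_Iio]; exact (Finset.mem_Iic.1 hj).trans_lt hi) fun i _ _ => hw i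
  have := hw i
  rw [cut, sum_Iic_fin, min_eq_right (by linarith), min_eq_right (by linarith), sub_self]

lemma cut_of_lt {n : ℕ} {w : Fin n → ℝ} (hw : ∀ i, 0 ≤ w i) {r : ℝ} {k i : Fin n}
    (hk : ∑ j ∈ Finset.Iio k, w j ≤ r) (hi : i < k) : cut r w i = w i := by
  have h1 : ∑ j ∈ Finset.Iic i, w j ≤ ∑ j ∈ Finset.Iio k, w j :=
    Finset.sum_le_sum_of_subset_of_nonneg (fun j hj => by
      rw [Finset.mem_Iio]; exact (Finset.mem_Iic.1 hj).trans_lt hi) fun i _ _ => hw i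
  have := hw i
  rw [sum_Iic_fin] at h1
  rw [cut, sum_Iic_fin, min_eq_left (by linarith), min_eq_left (by linarith)]
  ring


/-- The weights of the homotopy, before identification of the vertices. -/
noncomputable def cutPt {n : ℕ} (x : stdSimplex ℝ (Fin (n + 1)) × unitInterval) :
    stdSimplex ℝ (Fin ((n + 1 + n) + 1)) :=
  ⟨Fin.append (m := n + 1) (n := n + 1) (cut x.2 x.1) (fun i => x.1 i - cut x.2 x.1 i), by
    constructor
    · intro i
      refine Fin.addCases (m := n + 1) (n := n + 1) (fun i => ?_) (fun i => ?_) i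
      · rw [Fin.append_left]
        exact cut_nonneg _ _ (stdSimplex.zero_le x.1) _
      · rw [Fin.append_right]
        exact sub_nonneg.2 (cut_le _ _ (stdSimplex.zero_le x.1) _)
    · refine (Fin.sum_univ_add (a := n + 1) (b := n + 1) _).trans ?_
      simp only [Fin.append_left, Fin.append_right]
      rw [← Finset.sum_add_distrib, ← stdSimplex.sum_eq_one x.1]
      exact Finset.sum_congr rfl fun i _ => by ring⟩

lemma continuous_coord {n : ℕ} (i : Fin (n + 1)) :
    Continuous fun x : stdSimplex ℝ (Fin (n + 1)) × unitInterval => x.1 i :=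
  (continuous_apply i).comp (continuous_subtype_val.comp continuous_fst)

lemma continuous_par {n : ℕ} :
    Continuous fun x : stdSimplex ℝ (Fin (n + 1)) × unitInterval => (x.2 : ℝ) :=
  continuous_subtype_val.comp continuous_snd

lemma continuous_cut {n : ℕ} (i : Fin (n + 1)) :
    Continuous fun x : stdSimplex ℝ (Fin (n + 1)) × unitInterval => cut x.2 x.1 i := by
  unfold cut
  exact ((continuous_finsetSum _ fun j _ => continuous_coord j).min continuous_par).sub
    ((continuous_finsetSum _ fun j _ => continuous_coord j).min continuous_par)

lemma continuous_cutPt {n : ℕ} : Continuous (cutPt (n := n)) := by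
  refine Continuous.subtype_mk (continuous_pi fun i => ?_) _
  refine Fin.addCases (m := n + 1) (n := n + 1) (fun i => ?_) (fun i => ?_) i
  · simp only [Fin.append_left]
    exact continuous_cut i
  · simp only [Fin.append_right]
    exact (continuous_coord i).sub (continuous_cut i)

/-- The chain `f q₀ ≤ ⋯ ≤ f qₖ ≤ g qₖ ≤ ⋯ ≤ g qₙ`, with repetitions. -/
def cutChain {n : ℕ} (f g : P →o P) (hfg : ∀ p, f p ≤ g p) (q : Fin (n + 1) →o P)
    (k : Fin (n + 1)) : Fin ((n + 1 + n) + 1) →o P where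
  toFun := Fin.append (m := n + 1) (n := n + 1)
    (fun i => f (q (min i k))) (fun i => g (q (max i k)))
  monotone' := by
    intro a b
    refine Fin.addCases (m := n + 1) (n := n + 1) (fun i => ?_) (fun i => ?_) a <;>
    refine Fin.addCases (m := n + 1) (n := n + 1) (fun j => ?_) (fun j => ?_) b <;>
    intro hab <;> simp only [Fin.append_left, Fin.append_right]
    · have : i ≤ j := hab
      exact f.monotone (q.monotone (min_le_min_right _ this))
    · exact (f.monotone (q.monotone (min_le_right _ _))).trans
        ((hfg _).trans (g.monotone (q.monotone (le_max_right _ _))))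
    · exfalso
      simp only [Fin.le_def, Fin.val_natAdd, Fin.val_castAdd] at hab
      lia
    · have : i ≤ j := by
        simp only [Fin.le_def, Fin.val_natAdd] at hab ⊢
        lia
      exact g.monotone (q.monotone (max_le_max_right _ this))

open Classical in
/-- The weights of the homotopy. -/
noncomputable def homW {n : ℕ} (f g : P →o P) (q : Fin (n + 1) →o P)
    (x : stdSimplex ℝ (Fin (n + 1)) × unitInterval) (p : P) : ℝ :=
  ∑ i, cut x.2 x.1 i * (if f (q i) = p then 1 else 0) +
    ∑ i, (x.1 i - cut x.2 x.1 i) * (if g (q i) = p then 1 else 0)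

lemma wt_cutChain {n : ℕ} (f g : P →o P) (hfg : ∀ p, f p ≤ g p) (q : Fin (n + 1) →o P)
    (k : Fin (n + 1)) (x : stdSimplex ℝ (Fin (n + 1)) × unitInterval)
    (h1 : ∑ j ∈ Finset.Iio k, x.1 j ≤ x.2) (h2 : x.2 ≤ ∑ j ∈ Finset.Iic k, x.1 j) :
    wt (pt (cutChain f g hfg q k) (cutPt x)) = homW f g q x := by
  classical
  rw [wt_pt]
  funext p
  refine (Fin.sum_univ_add (a := n + 1) (b := n + 1) _).trans ?_
  unfold homW
  have e1 (i : Fin (n + 1)) : cutPt x (Fin.castAdd (n + 1) i) = cut x.2 x.1 i :=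
    Fin.append_left (m := n + 1) (n := n + 1)
      (cut x.2 x.1) (fun i => x.1 i - cut x.2 x.1 i) i
  have e2 (i : Fin (n + 1)) : cutPt x (Fin.natAdd (n + 1) i) = x.1 i - cut x.2 x.1 i :=
    Fin.append_right (m := n + 1) (n := n + 1)
      (cut x.2 x.1) (fun i => x.1 i - cut x.2 x.1 i) i
  have e3 (i : Fin (n + 1)) : cutChain f g hfg q k (Fin.castAdd (n + 1) i) = f (q (min i k)) :=
    Fin.append_left (m := n + 1) (n := n + 1)
      (fun i => f (q (min i k))) (fun i => g (q (max i k))) i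
  have e4 (i : Fin (n + 1)) : cutChain f g hfg q k (Fin.natAdd (n + 1) i) = g (q (max i k)) :=
    Fin.append_right (m := n + 1) (n := n + 1)
      (fun i => f (q (min i k))) (fun i => g (q (max i k))) i
  congr 1
  · refine Finset.sum_congr rfl fun i _ => ?_
    rw [e1, e3]
    rcases le_or_gt i k with h | h
    · rw [min_eq_left h]
    · rw [cut_of_gt (stdSimplex.zero_le x.1) h2 h, zero_mul, zero_mul]
  · refine Finset.sum_congr rfl fun i _ => ?_
    rw [e2, e4]
    rcases le_or_gt k i with h | h
    · rw [max_eq_left h]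
    · rw [cut_of_lt (stdSimplex.zero_le x.1) h1 h, sub_self, zero_mul, zero_mul]

lemma exists_simplex_homotopy (f g : P →o P) (hfg : ∀ p, f p ≤ g p) (n : ℕ)
    (q : Fin (n + 1) →o P) :
    ∃ h : C(stdSimplex ℝ (Fin (n + 1)) × unitInterval, SSet.toTop.obj (nerve P)),
      ∀ x, wt (h x) = homW f g q x := by
  have hex (x : stdSimplex ℝ (Fin (n + 1)) × unitInterval) :
      ∃ y : SSet.toTop.obj (nerve P), wt y = homW f g q x := by
    obtain ⟨k, h1, h2⟩ := exists_cut x.1 x.2 x.2.2.1 x.2.2.2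
    exact ⟨_, wt_cutChain f g hfg q k x h1 h2⟩
  choose h hh using hex
  refine ⟨⟨h, ?_⟩, hh⟩
  let A (k : Fin (n + 1)) : Set (stdSimplex ℝ (Fin (n + 1)) × unitInterval) :=
    {x | ∑ j ∈ Finset.Iio k, x.1 j ≤ x.2} ∩ {x | (x.2 : ℝ) ≤ ∑ j ∈ Finset.Iic k, x.1 j}
  refine (locallyFinite_of_finite A).continuous ?_ ?_ ?_
  · refine Set.eq_univ_of_forall fun x => Set.mem_iUnion.2 ?_
    exact exists_cut x.1 x.2 x.2.2.1 x.2.2.2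
  · intro k
    exact (isClosed_le (continuous_finsetSum _ fun j _ => continuous_coord j) continuous_par).inter
      (isClosed_le continuous_par (continuous_finsetSum _ fun j _ => continuous_coord j))
  · intro k
    refine ((pt (cutChain f g hfg q k)).continuous.comp continuous_cutPt).continuousOn.congr ?_
    intro x hx
    apply wt_injective
    rw [hh]
    exact (wt_cutChain f g hfg q k x hx.1 hx.2).symm

lemma sum_cut_map_mul {n m : ℕ} (r : ℝ) (hr : 0 ≤ r) (α : Fin n →o Fin m)
    (w : stdSimplex ℝ (Fin n)) (G : Fin m → ℝ) :
    ∑ j, cut r (stdSimplex.map α w) j * G j = ∑ i, cut r w i * G (α i) := by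
  have h := sum_cut_map r hr α w (stdSimplex.map α w) (fun j => by
    rw [stdSimplex.map_coe, FunOnFinite.linearMap_apply_apply])
  simp only [h, Finset.sum_mul]
  rw [← Finset.sum_fiberwise Finset.univ α]
  refine Finset.sum_congr rfl fun j _ => Finset.sum_congr rfl fun i hi => ?_
  rw [(Finset.mem_filter.1 hi).2]

lemma homW_map {n m : ℕ} (f g : P →o P) (q : Fin (m + 1) →o P) (α : Fin (n + 1) →o Fin (m + 1))
    (w : stdSimplex ℝ (Fin (n + 1))) (s : unitInterval) :
    homW f g (q.comp α) (w, s) = homW f g q (stdSimplex.map α w, s) := by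
  classical
  funext p
  unfold homW
  simp only [sub_mul, Finset.sum_sub_distrib]
  have h1 := sum_cut_map_mul s s.2.1 α w (fun j => if f (q j) = p then 1 else 0)
  have h2 := sum_cut_map_mul s s.2.1 α w (fun j => if g (q j) = p then 1 else 0)
  have h3 := sum_map_mul α w (fun j => if g (q j) = p then 1 else 0)
  rw [h1, h2, h3]
  rfl

lemma homW_zero {n : ℕ} (f g : P →o P) (q : Fin (n + 1) →o P) (w : stdSimplex ℝ (Fin (n + 1))) :
    homW f g q (w, 0) = wtf (g.comp q) w := by
  classical
  funext p
  unfold homW wtf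
  simp only [Set.Icc.coe_zero, cut_zero _ (stdSimplex.zero_le w), zero_mul, sub_zero,
    Finset.sum_const_zero, zero_add]
  rfl

lemma homW_one {n : ℕ} (f g : P →o P) (q : Fin (n + 1) →o P) (w : stdSimplex ℝ (Fin (n + 1))) :
    homW f g q (w, 1) = wtf (f.comp q) w := by
  classical
  funext p
  unfold homW wtf
  simp only [Set.Icc.coe_one, cut_one, zero_mul, sub_self, Finset.sum_const_zero, add_zero]
  rfl

lemma exists_homotopy (f g : P →o P) (hfg : ∀ p, f p ≤ g p) :
    ∃ F G : C(SSet.toTop.obj (nerve P), SSet.toTop.obj (nerve P)), F.Homotopic G ∧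
      (∀ (n : ℕ) (q : Fin (n + 1) →o P) (w : stdSimplex ℝ (Fin (n + 1))),
        F (pt q w) = pt (f.comp q) w) ∧
      (∀ (n : ℕ) (q : Fin (n + 1) →o P) (w : stdSimplex ℝ (Fin (n + 1))),
        G (pt q w) = pt (g.comp q) w) := by
  choose h hh using exists_simplex_homotopy f g hfg
  obtain ⟨Φ, hΦ⟩ := exists_lift (fun n q => (h n q).curry) (by
    intro n m q α w
    ext s
    apply wt_injective
    rw [ContinuousMap.curry_apply, ContinuousMap.curry_apply, hh, hh, homW_map])
  let K : C(SSet.toTop.obj (nerve P) × unitInterval, SSet.toTop.obj (nerve P)) := Φ.uncurry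
  have hK (n : ℕ) (q : Fin (n + 1) →o P) (w : stdSimplex ℝ (Fin (n + 1))) (s : unitInterval) :
      wt (K (pt q w, s)) = homW f g q (w, s) := by
    rw [← hh]
    exact congrArg (fun k => wt (k s)) (hΦ n q w)
  let G' : C(SSet.toTop.obj (nerve P), SSet.toTop.obj (nerve P)) :=
    ⟨fun y => K (y, 0), by fun_prop⟩
  let F' : C(SSet.toTop.obj (nerve P), SSet.toTop.obj (nerve P)) :=
    ⟨fun y => K (y, 1), by fun_prop⟩
  refine ⟨F', G', ?_, ?_, ?_⟩
  · refine ContinuousMap.Homotopic.symm ⟨⟨⟨fun x => K (x.2, x.1), by fun_prop⟩, ?_, ?_⟩⟩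
    · intro y; rfl
    · intro y; rfl
  · intro n q w
    apply wt_injective
    rw [wt_pt, ← homW_one f g]
    exact hK n q w 1
  · intro n q w
    apply wt_injective
    rw [wt_pt, ← homW_zero f g]
    exact hK n q w 0

lemma homotopic_of_le {f g : P →o P} (hfg : ∀ p, f p ≤ g p)
    {F G : C(SSet.toTop.obj (nerve P), SSet.toTop.obj (nerve P))}
    (hF : ∀ (n : ℕ) (q : Fin (n + 1) →o P) (w : stdSimplex ℝ (Fin (n + 1))),
        F (pt q w) = pt (f.comp q) w)
    (hG : ∀ (n : ℕ) (q : Fin (n + 1) →o P) (w : stdSimplex ℝ (Fin (n + 1))),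
        G (pt q w) = pt (g.comp q) w) : F.Homotopic G := by
  obtain ⟨F', G', h, h1, h2⟩ := exists_homotopy f g hfg
  have e1 : F = F' := hom_ext_pt fun n q w => (hF n q w).trans (h1 n q w).symm
  have e2 : G = G' := hom_ext_pt fun n q w => (hG n q w).trans (h2 n q w).symm
  rw [e1, e2]
  exact h

lemma exists_realization (f : P →o P) :
    ∃ F : C(SSet.toTop.obj (nerve P), SSet.toTop.obj (nerve P)),
      ∀ (n : ℕ) (q : Fin (n + 1) →o P) (w : stdSimplex ℝ (Fin (n + 1))),
        F (pt q w) = pt (f.comp q) w := by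
  obtain ⟨F, _, _, h, _⟩ := exists_homotopy f f (fun _ => le_rfl)
  exact ⟨F, h⟩

lemma pt_const (c : P) {n : ℕ} (q : Fin (n + 1) →o P) (w : stdSimplex ℝ (Fin (n + 1))) :
    pt ((OrderHom.const P c).comp q) w = pt (OrderHom.const (Fin 1) c) default := by
  rw [← Subsingleton.elim (stdSimplex.map (fun _ => 0) w) (default : stdSimplex ℝ (Fin 1))]
  exact pt_map (OrderHom.const (Fin 1) c) (OrderHom.const (Fin (n + 1)) (0 : Fin 1)) w

lemma contractible_of_homotopic (c : P)
    (h : ∀ F : C(SSet.toTop.obj (nerve P), SSet.toTop.obj (nerve P)),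
      (∀ (n : ℕ) (q : Fin (n + 1) →o P) (w : stdSimplex ℝ (Fin (n + 1))),
        F (pt q w) = pt ((OrderHom.const P c).comp q) w) →
      (ContinuousMap.id _).Homotopic F) : ContractibleSpace (SSet.toTop.obj (nerve P)) := by
  rw [contractible_iff_id_nullhomotopic]
  exact ⟨pt (OrderHom.const (Fin 1) c) default, h _ fun n q w => (pt_const c q w).symm⟩

end helpers

theorem statement12 (P : Type) [PartialOrder P] (c : P)
    (h : (∀ x : P, ∃ z : P, IsGLB {c, x} z) ∨ (∀ x : P, ∃ z : P, IsLUB {c, x} z)) :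
    ContractibleSpace (SSet.toTop.obj (nerve P)) := by
  apply contractible_of_homotopic c
  intro K hK
  have hid : ∀ (n : ℕ) (q : Fin (n + 1) →o P) (w : stdSimplex ℝ (Fin (n + 1))),
      (ContinuousMap.id (SSet.toTop.obj (nerve P))) (pt q w) = pt (OrderHom.id.comp q) w :=
    fun _ _ _ => rfl
  rcases h with h | h
  · choose m hm using h
    let f : P →o P := ⟨m, fun x y hxy => (hm y).2 (by
      rintro z (rfl | rfl)
      · exact (hm x).1 (by simp)
      · exact ((hm x).1 (by simp)).trans hxy)⟩
    obtain ⟨F, hF⟩ := exists_realization f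
    exact (homotopic_of_le (f := f) (g := OrderHom.id) (fun p => (hm p).1 (by simp)) hF hid).symm.trans
      (homotopic_of_le (f := f) (g := OrderHom.const P c) (fun p => (hm p).1 (by simp)) hF hK)
  · choose m hm using h
    let f : P →o P := ⟨m, fun x y hxy => (hm x).2 (by
      rintro z (rfl | rfl)
      · exact (hm y).1 (by simp)
      · exact hxy.trans ((hm y).1 (by simp)))⟩
    obtain ⟨F, hF⟩ := exists_realization f
    exact (homotopic_of_le (f := OrderHom.id) (g := f) (fun p => (hm p).1 (by simp)) hid hF).trans
      (homotopic_of_le (f := OrderHom.const P c) (g := f) (fun p => (hm p).1 (by simp)) hK hF).symm
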